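/- Fix P > 0, L ∈ ℝ, integers n ≥ 1 and 0 ≤ m ≤ n−1, an integer k ≥ 1, and ι ∈ {0,1}. Let a* = (a*_1,…,a*_n) be the vector with a*_i = ι for i ≤ m and a*_i = k for i > m, and let a = (a_1,…,a_n) be any vector of nonnegative reals with a*_i ≤ a_i for all i. Suppose t₀ ∈ (0,1) satisfies ∑_{i=1}^n [ (1/2)·log(1 + a_i P) − a_i P t₀/(1 + a_i P − a_i P t₀²) ] = L, that t* ∈ (0,1) satisfies ∑_{i=1}^n [ (1/2)·log(1 + a*_i P) − a*_i P t*/(1 + a*_i P − a*_i P (t*)²) ] = L, and that t̲, t̄ ∈ (0,1) satisfy t̲ ≤ t₀ ≤ t̄. Set T* := min{ t̲(1 − t̲), t̄(1 − t̄) }. Then exp(t₀ L − E(a,t₀)) / ( (t₀ − t₀²) · √(F(a,t₀)) ) ≤ exp(t* L − E(a*,t*)) / ( T* · √(F(a*, t̲)) ). -/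

import Mathlib

open Real Set Finset

/-- `E(a,t) = (1/2) ∑ᵢ [ t log(1 + aᵢP) + log(1 - aᵢP t²/(1 + aᵢP)) ]`. -/
noncomputable def E (P : ℝ) {n : ℕ} (a : Fin n → ℝ) (t : ℝ) : ℝ :=
  (1/2) * ∑ i, (t * Real.log (1 + a i * P) + Real.log (1 - a i * P * t ^ 2 / (1 + a i * P)))

/-- `F(a,t) = ∑ᵢ (aᵢP + (aᵢP)² + (aᵢP)²t²) / (1 + aᵢP - aᵢP t²)²`. -/
noncomputable def F (P : ℝ) {n : ℕ} (a : Fin n → ℝ) (t : ℝ) : ℝ :=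
  ∑ i, (a i * P + (a i * P) ^ 2 + (a i * P) ^ 2 * t ^ 2) / (1 + a i * P - a i * P * t ^ 2) ^ 2

lemma aux_split (x t : ℝ) (hx : 0 ≤ x) (h0 : 0 < t) (h1 : t < 1) :
    Real.log (1 - x * t ^ 2 / (1 + x)) = Real.log (1 + x - x * t ^ 2) - Real.log (1 + x) := by
  have ht : t ^ 2 < 1 := by nlinarith
  have hB : 0 < 1 + x - x * t ^ 2 := by nlinarith
  have h : 1 - x * t ^ 2 / (1 + x) = (1 + x - x * t ^ 2) / (1 + x) := by
    field_simp
  rw [h, Real.log_div hB.ne' (by positivity)]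

lemma aux_tangent (x t u : ℝ) (hx : 0 ≤ x) (h0 : 0 < t) (h1 : t < 1) (hu0 : 0 < u) (hu1 : u < 1) :
    (u * Real.log (1 + x) + Real.log (1 - x * u ^ 2 / (1 + x))) ≤
    (t * Real.log (1 + x) + Real.log (1 - x * t ^ 2 / (1 + x))) +
      2 * ((u - t) * ((1/2) * Real.log (1 + x) - x * t / (1 + x - x * t ^ 2))) := by
  rw [aux_split x t hx h0 h1, aux_split x u hx hu0 hu1]
  have ht : t ^ 2 < 1 := by nlinarith
  have hB : 0 < 1 + x - x * t ^ 2 := by nlinarith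
  have hu : u ^ 2 < 1 := by nlinarith
  have hA : 0 < 1 + x - x * u ^ 2 := by nlinarith
  have h := Real.log_le_sub_one_of_pos (div_pos hA hB)
  rw [Real.log_div hA.ne' hB.ne'] at h
  have h2 : (1 + x - x * u ^ 2) / (1 + x - x * t ^ 2) - 1 ≤
      -(2 * (u - t) * (x * t / (1 + x - x * t ^ 2))) := by
    have e : -(2 * (u - t) * (x * t / (1 + x - x * t ^ 2))) -
      ((1 + x - x * u ^ 2) / (1 + x - x * t ^ 2) - 1) = x * (u - t) ^ 2 / (1 + x - x * t ^ 2) := by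
      obtain ⟨B, hBd⟩ : ∃ B, B = 1 + x - x * t ^ 2 := ⟨_, rfl⟩
      rw [← hBd] at hB ⊢
      have hB' := hB.ne'
      field_simp
      rw [hBd]
      ring
    have : 0 ≤ x * (u - t) ^ 2 / (1 + x - x * t ^ 2) := by positivity
    linarith
  linarith

lemma aux_mono (x y t : ℝ) (hx : 0 ≤ x) (hxy : x ≤ y) (h0 : 0 < t) (h1 : t < 1) :
    (t * Real.log (1 + x) + Real.log (1 - x * t ^ 2 / (1 + x))) ≤
    (t * Real.log (1 + y) + Real.log (1 - y * t ^ 2 / (1 + y))) := by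
  have hy : 0 ≤ y := hx.trans hxy
  rw [aux_split x t hx h0 h1, aux_split y t hy h0 h1]
  have ht : t ^ 2 < 1 := by nlinarith
  have hB : 0 < 1 + x - x * t ^ 2 := by nlinarith
  have hA : 0 < 1 + y - y * t ^ 2 := by nlinarith
  have hd : 0 ≤ (y - x) / (1 + x) := div_nonneg (by linarith) (by linarith)
  have b := rpow_one_add_le_one_add_mul_self (s := (y - x) / (1 + x)) (p := 1 - t)
    (by linarith) (by linarith) (by linarith)
  have e1 : 1 + (y - x) / (1 + x) = (1 + y) / (1 + x) := by
    field_simp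
    ring
  have e2 : 1 + (1 - t) * ((y - x) / (1 + x)) ≤ (1 + y - y * t ^ 2) / (1 + x - x * t ^ 2) := by
    have : (1 + y - y * t ^ 2) / (1 + x - x * t ^ 2) - (1 + (1 - t) * ((y - x) / (1 + x)))
      = (1 - t) * (y - x) * t * (1 + x + x * t) / ((1 + x - x * t ^ 2) * (1 + x)) := by
      obtain ⟨B, hBd⟩ : ∃ B, B = 1 + x - x * t ^ 2 := ⟨_, rfl⟩
      rw [← hBd] at hB ⊢
      have hB' := hB.ne'
      field_simp
      rw [hBd]
      ring
    have h : 0 ≤ (1 - t) * (y - x) * t * (1 + x + x * t) / ((1 + x - x * t ^ 2) * (1 + x)) := by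
      have := sub_nonneg.2 hxy
      have := sub_nonneg.2 h1.le
      positivity
    linarith
  have hpos : 0 < (1 + y) / (1 + x) := by positivity
  rw [e1] at b
  have l := Real.log_le_log (Real.rpow_pos_of_pos hpos _) (b.trans e2)
  rw [Real.log_rpow hpos, Real.log_div (by positivity) (by positivity),
    Real.log_div hA.ne' hB.ne'] at l
  linarith

lemma aux_F_t (x s t : ℝ) (hx : 0 ≤ x) (h0 : 0 < s) (hst : s ≤ t) (h1 : t < 1) :
    (x + x ^ 2 + x ^ 2 * s ^ 2) / (1 + x - x * s ^ 2) ^ 2 ≤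
    (x + x ^ 2 + x ^ 2 * t ^ 2) / (1 + x - x * t ^ 2) ^ 2 := by
  have ht : t ^ 2 < 1 := by nlinarith
  have hs : s ^ 2 ≤ t ^ 2 := by gcongr
  have hB : 0 < 1 + x - x * t ^ 2 := by nlinarith
  gcongr

lemma aux_F_x (x y t : ℝ) (hx : 0 ≤ x) (hxy : x ≤ y) (h0 : 0 < t) (h1 : t < 1) :
    (x + x ^ 2 + x ^ 2 * t ^ 2) / (1 + x - x * t ^ 2) ^ 2 ≤
    (y + y ^ 2 + y ^ 2 * t ^ 2) / (1 + y - y * t ^ 2) ^ 2 := by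
  have ht : t ^ 2 < 1 := by nlinarith
  have hB : 0 < 1 + x - x * t ^ 2 := by nlinarith
  have hA : 0 < 1 + y - y * t ^ 2 := by nlinarith
  rw [div_le_div_iff₀ (by positivity) (by positivity)]
  obtain ⟨d, rfl⟩ : ∃ d, y = x + d := ⟨y - x, by ring⟩
  obtain ⟨q, hq⟩ : ∃ q, q = 1 - t ^ 2 := ⟨_, rfl⟩
  have ht2 : t ^ 2 = 1 - q := by linarith
  have hq0 : 0 ≤ q := by linarith
  have hq1 : 0 ≤ 1 - q := by nlinarith
  have hd : 0 ≤ d := by linarith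
  rw [ht2]
  have : ((x + d) + (x + d) ^ 2 + (x + d) ^ 2 * (1 - q)) * (1 + x - x * (1 - q)) ^ 2 -
     (x + x ^ 2 + x ^ 2 * (1 - q)) * (1 + (x + d) - (x + d) * (1 - q)) ^ 2
     = d * (1 + (2 - q) * (2 * x + d) + 2 * q * (2 - q) * x * (x + d) - q ^ 2 * x * (x + d)) := by
    ring
  have h2 : 0 ≤ d * (1 + (2 - q) * (2 * x + d) + 2 * q * (2 - q) * x * (x + d) - q ^ 2 * x * (x + d)) := by
    have : 1 + (2 - q) * (2 * x + d) + 2 * q * (2 - q) * x * (x + d) - q ^ 2 * x * (x + d)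
     = 1 + (1 + (1 - q)) * (2 * x + d) + (q + 3 * q * (1 - q)) * x * (x + d) := by ring
    rw [this]
    positivity
  linarith

/-- **Analytic core of Theorem 2 (Appendix B).** For the worst-case pattern
`a* = [ι^m, k^(n-m)]` and any pattern `a ≥ a*` coordinatewise, with `t₀` the saddlepoint
of `a`, `t*` the saddlepoint of `a*`, and `t̲ ≤ t₀ ≤ t̄` in `(0,1)`, setting
`T* = min{t̲(1-t̲), t̄(1-t̄)}`, one has
`g₁(a,t₀) g₂(a,t₀) ≤ g₁(a*,t*) / (T* √(F(a*,t̲)))`. -/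
theorem uniform_saddlepoint_bound
    (P L : ℝ) (hP : 0 < P) (n m k : ℕ) (hn : 1 ≤ n) (hm : m ≤ n - 1) (hk : 1 ≤ k)
    (ι : ℝ) (hι : ι = 0 ∨ ι = 1)
    (astar a : Fin n → ℝ)
    (hastar : ∀ i : Fin n, astar i = if (i : ℕ) < m then ι else (k : ℝ))
    (ha : ∀ i, 0 ≤ a i) (hdom : ∀ i, astar i ≤ a i)
    (t₀ : ℝ) (ht₀ : t₀ ∈ Set.Ioo (0 : ℝ) 1)
    (ht₀stat : ∑ i, ((1/2) * Real.log (1 + a i * P) -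
        a i * P * t₀ / (1 + a i * P - a i * P * t₀ ^ 2)) = L)
    (tstar : ℝ) (htstar : tstar ∈ Set.Ioo (0 : ℝ) 1)
    (htstarstat : ∑ i, ((1/2) * Real.log (1 + astar i * P) -
        astar i * P * tstar / (1 + astar i * P - astar i * P * tstar ^ 2)) = L)
    (tlo thi : ℝ) (htlo : tlo ∈ Set.Ioo (0 : ℝ) 1) (hthi : thi ∈ Set.Ioo (0 : ℝ) 1)
    (hlo : tlo ≤ t₀) (hhi : t₀ ≤ thi) :
    Real.exp (t₀ * L - E P a t₀) / ((t₀ - t₀ ^ 2) * Real.sqrt (F P a t₀)) ≤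
      Real.exp (tstar * L - E P astar tstar) /
        (min (tlo * (1 - tlo)) (thi * (1 - thi)) * Real.sqrt (F P astar tlo)) := by
  obtain ⟨a0, a1⟩ := ht₀
  obtain ⟨b0, b1⟩ := htstar
  obtain ⟨c0, c1⟩ := htlo
  obtain ⟨d0, d1⟩ := hthi
  have hs : ∀ i, 0 ≤ astar i := by
    intro i
    rw [hastar]
    split_ifs
    · rcases hι with h | h <;> simp [h]
    · positivity
  have hxs : ∀ i, 0 ≤ astar i * P := fun i => mul_nonneg (hs i) hP.le
  have hxa : ∀ i, 0 ≤ a i * P := fun i => mul_nonneg (ha i) hP.le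
  have hxd : ∀ i, astar i * P ≤ a i * P := fun i => mul_le_mul_of_nonneg_right (hdom i) hP.le
  have hE1 : E P astar tstar ≤ E P a tstar := by
    unfold E
    gcongr (1/2) * ?_
    exact Finset.sum_le_sum fun i _ => aux_mono _ _ _ (hxs i) (hxd i) b0 b1
  have hE2 : E P a tstar ≤ E P a t₀ + (tstar - t₀) * L := by
    have h := Finset.sum_le_sum fun i (_ : i ∈ Finset.univ) =>
      aux_tangent (a i * P) t₀ tstar (hxa i) a0 a1 b0 b1
    have h' := h.trans_eq Finset.sum_add_distrib
    rw [← Finset.mul_sum Finset.univ (fun i => (tstar - t₀) * _) 2,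
      ← Finset.mul_sum Finset.univ _ (tstar - t₀), ht₀stat] at h'
    unfold E
    linarith
  have hF : F P astar tlo ≤ F P a t₀ := by
    unfold F
    exact Finset.sum_le_sum fun i _ => (aux_F_t _ _ _ (hxs i) c0 hlo a1).trans
      (aux_F_x _ _ _ (hxs i) (hxd i) a0 a1)
  have hFpos : 0 < F P astar tlo := by
    unfold F
    have ht : tlo ^ 2 < 1 := by nlinarith
    have hB : ∀ i, 0 < 1 + astar i * P - astar i * P * tlo ^ 2 := fun i => by
      nlinarith [hxs i]
    apply Finset.sum_pos'
    · intro i _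
      have := hxs i
      positivity
    · refine ⟨⟨n - 1, by omega⟩, Finset.mem_univ _, ?_⟩
      have hp : 0 < astar ⟨n - 1, by omega⟩ * P := by
        rw [hastar, if_neg (by simpa using hm)]
        have : (0 : ℝ) < k := by exact_mod_cast hk
        positivity
      have := hB ⟨n - 1, by omega⟩
      positivity
  have hT : min (tlo * (1 - tlo)) (thi * (1 - thi)) ≤ t₀ - t₀ ^ 2 := by
    rcases le_total (t₀ + tlo) 1 with h | h
    · refine (min_le_left _ _).trans ?_
      nlinarith
    · refine (min_le_right _ _).trans ?_
      nlinarith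
  have hTpos : 0 < min (tlo * (1 - tlo)) (thi * (1 - thi)) :=
    lt_min (mul_pos c0 (by linarith)) (mul_pos d0 (by linarith))
  have hsq := Real.sqrt_pos.2 hFpos
  apply div_le_div₀ (Real.exp_pos _).le
  · apply Real.exp_le_exp.2
    linarith
  · positivity
  · exact mul_le_mul hT (Real.sqrt_le_sqrt hF) hsq.le (hTpos.le.trans hT)
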